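/- Let N ≥ 1 and p > 1. Let Γ : ℝ^N × ℝ^N × (0,∞) → ℝ be a measurable nonnegative kernel satisfying ∫_{ℝ^N} Γ(x,y,t) dy = 1 for all x ∈ ℝ^N, t > 0, and the Chapman–Kolmogorov property (K2): Γ(x,y,t) = ∫_{ℝ^N} Γ(x,ξ,t−s) Γ(ξ,y,s) dξ for all x, y ∈ ℝ^N and t > s > 0. Then there exists a constant C_* depending only on p (in particular, independent of Γ, φ and T) with the following property: if 0 < T ≤ ∞, φ is a nonnegative measurable function on ℝ^N, and u is a mild solution of u_t = div(w∇u) + u^p with kernel Γ and initial data φ on ℝ^N × (0,T), then t^{1/(p−1)} · ess sup_{x ∈ ℝ^N} ∫_{ℝ^N} Γ(x,y,t) φ(y) dy ≤ C_* for every t ∈ (0,T). -/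

import Mathlib

open MeasureTheory Real Set
open scoped ENNReal

noncomputable section

/-- `N`-dimensional Euclidean space. -/
abbrev E (N : ℕ) : Type := EuclideanSpace ℝ (Fin N)

/-- A mild solution of `u_t = div(w ∇u) + u^p` with kernel `Γ` and initial data `φ`
on `ℝ^N × (0,T)` (`T ∈ (0,∞]`): a nonnegative measurable function, essentially bounded
on `ℝ^N × (0,T)`, satisfying the Duhamel integral identity (with all integrals finite). -/
def IsMildSolution (N : ℕ) (p : ℝ) (Γ : E N → E N → ℝ → ℝ)
    (φ : E N → ℝ) (T : ℝ≥0∞) (u : E N → ℝ → ℝ) : Prop :=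
  Measurable (fun q : E N × ℝ => u q.1 q.2) ∧
  (∀ x t, 0 ≤ u x t) ∧
  (∃ M : ℝ, ∀ t : ℝ, 0 < t → ENNReal.ofReal t < T →
    ∀ᵐ x : E N ∂volume, u x t ≤ M) ∧
  (∀ t : ℝ, 0 < t → ENNReal.ofReal t < T →
    ∀ᵐ x : E N ∂volume,
      Integrable (fun y => Γ x y t * φ y) volume ∧
      Integrable (fun q : E N × ℝ => Γ x q.1 (t - q.2) * u q.1 q.2 ^ p)
        (volume.prod (volume.restrict (Ioo (0:ℝ) t))) ∧
      u x t = (∫ y, Γ x y t * φ y) +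
        ∫ s in Ioo (0:ℝ) t, ∫ y, Γ x y (t - s) * u y s ^ p)

/-- The weak `L^r` quasinorm `‖f‖_{r,∞} = sup_{λ>0} λ |{|f|>λ}|^{1/r}`. -/
def weakNorm (N : ℕ) (r : ℝ) (f : E N → ℝ) : ℝ≥0∞ :=
  ⨆ (l : ℝ) (_ : 0 < l), ENNReal.ofReal l * (volume {x : E N | l < |f x|}) ^ (1 / r)

/-- A function on `(0, t)` bounded below by `A > 0` with `g b ≥ g a + (b - a) g(a)^p` and `p > 1`
doubles too often to stay finite, unless `t ^ (1 / (p - 1)) * A` is small. -/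
theorem rpow_mul_le_of_superlinear_growth {p t A : ℝ} (hp : 1 < p) (ht : 0 < t) (hA : 0 < A)
    {g : ℝ → ℝ} (hg0 : ∀ τ, 0 < τ → τ < t → A ≤ g τ)
    (hg : ∀ a b, 0 < a → a < b → b < t → g a + (b - a) * g a ^ p ≤ g b) :
    t ^ (1 / (p - 1)) * A ≤ (2 / (1 - (2 : ℝ) ^ (1 - p))) ^ (1 / (p - 1)) := by
  have hr0 : (0 : ℝ) < 2 ^ (1 - p) := by positivity
  have hr1 : (2 : ℝ) ^ (1 - p) < 1 := Real.rpow_lt_one_of_one_lt_of_neg (by norm_num) (by linarith)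
  set r : ℝ := 2 ^ (1 - p) with hr
  have hAp : 0 < A ^ (1 - p) := by positivity
  have doubling : ∀ k : ℕ, ∀ τ, t / 4 + A ^ (1 - p) * ∑ j ∈ Finset.range k, r ^ j ≤ τ → τ < t →
      A * 2 ^ k ≤ g τ := by
    intro k
    induction k with
    | zero =>
      intro τ h1 h2
      simp only [Finset.range_zero, Finset.sum_empty, mul_zero, add_zero] at h1
      simpa using hg0 τ (by linarith) h2
    | succ k ih =>
      intro τ h1 h2
      rw [Finset.sum_range_succ, mul_add] at h1
      have hd : 0 < A ^ (1 - p) * r ^ k := by positivity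
      have hS : 0 ≤ A ^ (1 - p) * ∑ j ∈ Finset.range k, r ^ j :=
        mul_nonneg hAp.le (Finset.sum_nonneg fun j _ => by positivity)
      have h3 := ih (τ - A ^ (1 - p) * r ^ k) (by linarith) (by linarith)
      have h4 := hg (τ - A ^ (1 - p) * r ^ k) τ (by linarith) (by linarith) h2
      have hB : 0 < A * 2 ^ k := by positivity
      have h5 : A ^ (1 - p) * r ^ k * (A * 2 ^ k) ^ p = A * 2 ^ k := by
        have : A ^ (1 - p) * r ^ k = (A * 2 ^ k) ^ (1 - p) := by
          rw [Real.mul_rpow hA.le (by positivity), hr, ← Real.rpow_natCast, ← Real.rpow_natCast,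
            ← Real.rpow_mul (by norm_num), ← Real.rpow_mul (by norm_num), mul_comm (1 - p)]
        rw [this, ← Real.rpow_add hB]
        simp
      have h6 : A ^ (1 - p) * r ^ k * (A * 2 ^ k) ^ p
          ≤ A ^ (1 - p) * r ^ k * g (τ - A ^ (1 - p) * r ^ k) ^ p := by
        gcongr
      have h7 : τ - (τ - A ^ (1 - p) * r ^ k) = A ^ (1 - p) * r ^ k := by ring
      rw [h7] at h4
      rw [pow_succ]
      linarith
  by_contra! hcon
  have hC : 0 < 2 / (1 - r) := div_pos two_pos (by linarith)
  have hq : 0 < p - 1 := by linarith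
  have h1 : 2 / (1 - r) < t * A ^ (p - 1) := by
    have := Real.rpow_lt_rpow (by positivity) hcon hq
    rw [Real.mul_rpow (by positivity) hA.le, ← Real.rpow_mul hC.le, ← Real.rpow_mul ht.le,
      one_div_mul_cancel hq.ne', Real.rpow_one, Real.rpow_one] at this
    exact this
  have h2 : A ^ (1 - p) * (1 - r)⁻¹ < t / 2 := by
    have h3 : A ^ (1 - p) * A ^ (p - 1) = 1 := by rw [← Real.rpow_add hA]; simp
    have h4 := mul_lt_mul_of_pos_left h1 hAp
    have h5 : A ^ (1 - p) * (t * A ^ (p - 1)) = t := by rw [mul_left_comm, h3, mul_one]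
    rw [h5, div_eq_mul_inv] at h4
    linarith
  obtain ⟨k, hk⟩ := pow_unbounded_of_one_lt (g (t * (3 / 4)) / A) (one_lt_two (α := ℝ))
  rw [div_lt_iff₀ hA, mul_comm _ A] at hk
  refine absurd (doubling k (t * (3 / 4)) ?_ (by linarith)) hk.not_ge
  have hsum : ∑ j ∈ Finset.range k, r ^ j ≤ (1 - r)⁻¹ := by
    rw [← tsum_geometric_of_lt_one hr0.le hr1]
    exact (summable_geometric_of_lt_one hr0.le hr1).sum_le_tsum _ fun j _ => by positivity
  have := mul_le_mul_of_nonneg_left hsum hAp.le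
  linarith

section Kernel

variable {α : Type*} [MeasurableSpace α] {μ : Measure α}

/-- Jensen's inequality for the power `p ≥ 1` and a probability density `k`. -/
theorem rpow_lintegral_mul_le_lintegral_mul_rpow {p : ℝ} (hp : 1 ≤ p) {k f : α → ℝ≥0∞}
    (hk : Measurable k) (hf : Measurable f) (hk1 : ∫⁻ y, k y ∂μ = 1) :
    (∫⁻ y, k y * f y ∂μ) ^ p ≤ ∫⁻ y, k y * f y ^ p ∂μ := by
  have : IsProbabilityMeasure (μ.withDensity k) := ⟨by simpa using hk1⟩
  have h := eLpNorm'_le_eLpNorm'_of_exponent_le one_pos hp (μ.withDensity k)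
    hf.aestronglyMeasurable
  simp only [eLpNorm', enorm_eq_self, ENNReal.rpow_one, div_one] at h
  rw [lintegral_withDensity_eq_lintegral_mul _ hk hf,
    lintegral_withDensity_eq_lintegral_mul _ hk (hf.pow_const p)] at h
  have h2 := ENNReal.rpow_le_rpow h (by linarith : 0 ≤ p)
  rwa [← ENNReal.rpow_mul, one_div_mul_cancel (by linarith), ENNReal.rpow_one] at h2

variable [SFinite μ]

theorem lintegral_mul_le_lintegral_mul_lintegral_mul {k l : α → ℝ≥0∞} {m : α → α → ℝ≥0∞}
    (hl : Measurable l) (hm : Measurable (Function.uncurry m))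
    (hk : ∀ z, k z ≤ ∫⁻ y, l y * m y z ∂μ) {f : α → ℝ≥0∞} (hf : Measurable f) :
    ∫⁻ z, k z * f z ∂μ ≤ ∫⁻ y, l y * ∫⁻ z, m y z * f z ∂μ ∂μ := by
  have hm' : Measurable fun q : α × α => m q.1 q.2 := hm
  have hmy : ∀ y, Measurable fun z => m y z := fun y => hm'.comp measurable_prodMk_left
  have hmz : ∀ z, Measurable fun y => m y z := fun z => hm'.comp measurable_prodMk_right
  calc ∫⁻ z, k z * f z ∂μ ≤ ∫⁻ z, ∫⁻ y, l y * (m y z * f z) ∂μ ∂μ := by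
        refine lintegral_mono fun z => (mul_le_mul_left (hk z) (f z)).trans_eq ?_
        rw [← lintegral_mul_const (f z) (f := fun y => l y * m y z) (hl.mul (hmz z))]
        simp only [mul_assoc]
    _ = ∫⁻ y, ∫⁻ z, l y * (m y z * f z) ∂μ ∂μ := by
        refine lintegral_lintegral_swap (Measurable.aemeasurable ?_)
        exact (hl.comp measurable_snd).mul
          ((hm'.comp measurable_swap).mul (hf.comp measurable_fst))
    _ = ∫⁻ y, l y * ∫⁻ z, m y z * f z ∂μ ∂μ := by
        refine lintegral_congr fun y => ?_
        exact lintegral_const_mul (l y) ((hmy y).mul hf)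

/-- Applying the kernel at time `t - τ` to a supersolution of the Duhamel identity at time `τ`. -/
theorem duhamel_le_lintegral_kernel_mul {g : α → α → ℝ → ℝ≥0∞}
    (hg : Measurable fun q : α × α × ℝ => g q.1 q.2.1 q.2.2)
    (hCK : ∀ x z s t, 0 < s → s < t → g x z t ≤ ∫⁻ y, g x y (t - s) * g y z s ∂μ)
    {Φ : α → ℝ≥0∞} (hΦ : Measurable Φ) {V : α → ℝ → ℝ≥0∞}
    (hV : Measurable fun q : α × ℝ => V q.1 q.2) {W : α → ℝ≥0∞} {t τ : ℝ} (hτ : 0 < τ)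
    (hτt : τ < t)
    (hW : ∀ᵐ y ∂μ, ∫⁻ z, g y z τ * Φ z ∂μ
      + ∫⁻ s in Ioo 0 τ, ∫⁻ z, g y z (τ - s) * V z s ∂μ ≤ W y) (x : α) :
    ∫⁻ z, g x z t * Φ z ∂μ + ∫⁻ s in Ioo 0 τ, ∫⁻ z, g x z (t - s) * V z s ∂μ
      ≤ ∫⁻ y, g x y (t - τ) * W y ∂μ := by
  have hgx : ∀ x r, Measurable fun y => g x y r := fun x r => by fun_prop
  have hgr : ∀ r, Measurable (Function.uncurry fun y z => g y z r) := fun r =>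
    hg.comp (measurable_fst.prodMk (measurable_snd.prodMk measurable_const))
  have hgV : Measurable fun q : (α × ℝ) × α => g q.1.1 q.2 (τ - q.1.2) * V q.2 q.1.2 := by
    refine Measurable.mul ?_ ?_
    · exact hg.comp (measurable_fst.fst.prodMk
        (measurable_snd.prodMk (measurable_const.sub measurable_fst.snd)))
    · exact hV.comp (measurable_snd.prodMk measurable_fst.snd)
  have hint : Measurable fun q : α × ℝ => ∫⁻ z, g q.1 z (τ - q.2) * V z q.2 ∂μ :=
    hgV.lintegral_prod_right'
  have hΦint : Measurable fun y => ∫⁻ z, g y z τ * Φ z ∂μ := by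
    refine Measurable.lintegral_prod_right' (f := fun q : α × α => g q.1 q.2 τ * Φ q.2) ?_
    exact (hgr τ).mul (hΦ.comp measurable_snd)
  calc _ ≤ ∫⁻ y, g x y (t - τ) * ∫⁻ z, g y z τ * Φ z ∂μ ∂μ
        + ∫⁻ s in Ioo 0 τ, ∫⁻ y, g x y (t - τ) * ∫⁻ z, g y z (τ - s) * V z s ∂μ ∂μ := by
        refine add_le_add ?_ ?_
        · exact lintegral_mul_le_lintegral_mul_lintegral_mul (hgx _ _) (hgr τ)
            (fun z => hCK x z τ t hτ hτt) hΦ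
        · refine setLIntegral_mono' measurableSet_Ioo fun s hs => ?_
          refine lintegral_mul_le_lintegral_mul_lintegral_mul (hgx _ _) (hgr (τ - s))
            (fun z => ?_) (hV.comp measurable_prodMk_right)
          have := hCK x z (τ - s) (t - s) (by linarith [hs.2]) (by linarith)
          rwa [sub_sub_sub_cancel_right] at this
    _ = ∫⁻ y, g x y (t - τ) * ∫⁻ z, g y z τ * Φ z ∂μ ∂μ
        + ∫⁻ y, g x y (t - τ) * (∫⁻ s in Ioo 0 τ, ∫⁻ z, g y z (τ - s) * V z s ∂μ) ∂μ := by
        rw [lintegral_lintegral_swap]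
        · congr 1
          refine lintegral_congr fun y => ?_
          exact lintegral_const_mul _ (hint.comp measurable_prodMk_left)
        · exact (((hgx x (t - τ)).comp measurable_snd).mul
            (hint.comp measurable_swap)).aemeasurable
    _ = ∫⁻ y, g x y (t - τ) * (∫⁻ z, g y z τ * Φ z ∂μ
        + ∫⁻ s in Ioo 0 τ, ∫⁻ z, g y z (τ - s) * V z s ∂μ) ∂μ := by
        rw [← lintegral_add_left (f := fun y => g x y (t - τ) * ∫⁻ z, g y z τ * Φ z ∂μ)
          ((hgx _ _).mul hΦint)]
        simp only [mul_add]
    _ ≤ _ := lintegral_mono_ae (hW.mono fun y hy => mul_le_mul_right hy _)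

/-- A priori bound for bounded supersolutions of the Duhamel identity with a sub-Chapman–Kolmogorov
Markov kernel. -/
theorem rpow_mul_lintegral_kernel_le {p t : ℝ} (hp : 1 < p) (ht : 0 < t) {g : α → α → ℝ → ℝ≥0∞}
    (hg : Measurable fun q : α × α × ℝ => g q.1 q.2.1 q.2.2)
    (hg1 : ∀ x t, 0 < t → ∫⁻ y, g x y t ∂μ = 1)
    (hCK : ∀ x z s t, 0 < s → s < t → g x z t ≤ ∫⁻ y, g x y (t - s) * g y z s ∂μ)
    {Φ : α → ℝ≥0∞} (hΦ : Measurable Φ) {U : α → ℝ → ℝ≥0∞}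
    (hU : Measurable fun q : α × ℝ => U q.1 q.2) {M : ℝ≥0∞} (hM : M ≠ ⊤)
    (hUM : ∀ τ, 0 < τ → τ < t → ∀ᵐ y ∂μ, U y τ ≤ M)
    (hDuh : ∀ τ, 0 < τ → τ < t → ∀ᵐ y ∂μ, ∫⁻ z, g y z τ * Φ z ∂μ
      + ∫⁻ s in Ioo 0 τ, ∫⁻ z, g y z (τ - s) * U z s ^ p ∂μ ≤ U y τ) (x : α) :
    ENNReal.ofReal (t ^ (1 / (p - 1))) * ∫⁻ z, g x z t * Φ z ∂μ
      ≤ ENNReal.ofReal ((2 / (1 - (2 : ℝ) ^ (1 - p))) ^ (1 / (p - 1))) := by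
  have hgx : ∀ r, Measurable fun y => g x y r := fun r => by fun_prop
  have hUs : ∀ s, Measurable fun y => U y s := fun s => hU.comp measurable_prodMk_right
  set A := ∫⁻ z, g x z t * Φ z ∂μ
  set H : ℝ → ℝ≥0∞ := fun s => ∫⁻ z, g x z (t - s) * U z s ^ p ∂μ
  set F : ℝ → ℝ≥0∞ := fun s => ∫⁻ z, g x z (t - s) * U z s ∂μ
  set G : ℝ → ℝ≥0∞ := fun τ => A + ∫⁻ s in Ioo 0 τ, H s
  have hGF : ∀ τ, 0 < τ → τ < t → G τ ≤ F τ := fun τ h0 h1 =>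
    duhamel_le_lintegral_kernel_mul hg hCK hΦ (hU.pow_const p) h0 h1 (hDuh τ h0 h1) x
  have hFH : ∀ s, s < t → F s ^ p ≤ H s := fun s h1 =>
    rpow_lintegral_mul_le_lintegral_mul_rpow hp.le (hgx _) (hUs s) (hg1 x _ (by linarith))
  have hFM : ∀ τ, 0 < τ → τ < t → F τ ≤ M := fun τ h0 h1 =>
    calc F τ ≤ ∫⁻ z, g x z (t - τ) * M ∂μ :=
          lintegral_mono_ae ((hUM τ h0 h1).mono fun y hy => mul_le_mul_right hy _)
      _ = M := by rw [lintegral_mul_const _ (hgx _), hg1 x _ (by linarith), one_mul]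
  have hGtop : ∀ τ, 0 < τ → τ < t → G τ ≠ ⊤ := fun τ h0 h1 =>
    ne_top_of_le_ne_top hM ((hGF τ h0 h1).trans (hFM τ h0 h1))
  have hAtop : A ≠ ⊤ := ne_top_of_le_ne_top (hGtop (t / 2) (by linarith) (by linarith)) le_self_add
  have hGmono : Monotone G := fun a b hab =>
    add_le_add le_rfl (lintegral_mono_set (Ioo_subset_Ioo_right hab))
  have hstep : ∀ a b, 0 < a → a < b → b < t → G a + ENNReal.ofReal (b - a) * G a ^ p ≤ G b := by
    intro a b ha hab hb
    calc G a + ENNReal.ofReal (b - a) * G a ^ p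
        ≤ A + ((∫⁻ s in Ioo 0 a, H s) + ∫⁻ s in Ioo a b, H s) := by
          rw [← add_assoc]
          refine add_le_add le_rfl ?_
          calc ENNReal.ofReal (b - a) * G a ^ p = ∫⁻ _ in Ioo a b, G a ^ p := by
                rw [setLIntegral_const, Real.volume_Ioo, mul_comm]
            _ ≤ ∫⁻ s in Ioo a b, H s := by
                refine setLIntegral_mono' measurableSet_Ioo fun s hs => ?_
                have hst : s < t := hs.2.trans hb
                exact (ENNReal.rpow_le_rpow ((hGmono hs.1.le).trans (hGF s (ha.trans hs.1) hst))
                  (by linarith)).trans (hFH s hst)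
      _ ≤ G b := by
          refine add_le_add le_rfl ?_
          rw [← lintegral_union measurableSet_Ioo
            (Set.disjoint_left.2 fun s h1 h2 => absurd h1.2 h2.1.not_gt)]
          exact lintegral_mono_set (union_subset (Ioo_subset_Ioo_right hab.le)
            (Ioo_subset_Ioo_left ha.le))
  rcases eq_or_ne A 0 with h0 | h0
  · simp [h0]
  have key := rpow_mul_le_of_superlinear_growth hp ht (ENNReal.toReal_pos h0 hAtop)
    (g := fun τ => (G τ).toReal)
    (fun τ h1 h2 => ENNReal.toReal_mono (hGtop τ h1 h2) le_self_add) (by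
      intro a b ha hab hb
      have hat := hGtop a ha (hab.trans hb)
      have h := ENNReal.toReal_mono (hGtop b (ha.trans hab) hb) (hstep a b ha hab hb)
      rwa [ENNReal.toReal_add hat
        (ENNReal.mul_ne_top ENNReal.ofReal_ne_top (ENNReal.rpow_ne_top_of_nonneg (by linarith) hat)),
        ENNReal.toReal_mul, ENNReal.toReal_ofReal (by linarith), ← ENNReal.toReal_rpow] at h)
  rw [← ENNReal.ofReal_toReal hAtop, ← ENNReal.ofReal_mul (by positivity)]
  exact ENNReal.ofReal_le_ofReal key

end Kernel

theorem ofReal_integral_le_lintegral_ofReal {α : Type*} [MeasurableSpace α] {μ : Measure α}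
    {f : α → ℝ} (hf : 0 ≤ᵐ[μ] f) :
    ENNReal.ofReal (∫ x, f x ∂μ) ≤ ∫⁻ x, ENNReal.ofReal (f x) ∂μ := by
  by_cases h : Integrable f μ
  · exact (ofReal_integral_eq_lintegral_ofReal h hf).le
  · simp [integral_undef h]

/-- The Duhamel identity for a mild solution, in `ℝ≥0∞`-valued form. -/
theorem IsMildSolution.lintegral_duhamel {N : ℕ} {p : ℝ} {Γ : E N → E N → ℝ → ℝ} {φ : E N → ℝ}
    {T : ℝ≥0∞} {u : E N → ℝ → ℝ} (hu : IsMildSolution N p Γ φ T u) (hp0 : 0 ≤ p)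
    (hΓ0 : ∀ x y : E N, ∀ t : ℝ, 0 < t → 0 ≤ Γ x y t) (hφ0 : ∀ x, 0 ≤ φ x)
    {t : ℝ} (ht : 0 < t) (htT : ENNReal.ofReal t < T) :
    ∀ᵐ x : E N, ENNReal.ofReal (u x t) =
      (∫⁻ y, ENNReal.ofReal (Γ x y t) * ENNReal.ofReal (φ y))
        + ∫⁻ s in Ioo 0 t, ∫⁻ y, ENNReal.ofReal (Γ x y (t - s)) * ENNReal.ofReal (u y s) ^ p := by
  obtain ⟨-, hu0, -, hD⟩ := hu
  filter_upwards [hD t ht htT] with x hx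
  obtain ⟨h1, h2, h3⟩ := hx
  have hs : ∀ᵐ q : E N × ℝ ∂(volume.prod (volume.restrict (Ioo (0 : ℝ) t))), q.2 ∈ Ioo 0 t :=
    Measure.quasiMeasurePreserving_snd.ae (ae_restrict_mem measurableSet_Ioo)
  have hpos : ∀ y s, s ∈ Ioo 0 t → 0 ≤ Γ x y (t - s) * u y s ^ p := fun y s hs =>
    mul_nonneg (hΓ0 x y _ (sub_pos.2 hs.2)) (Real.rpow_nonneg (hu0 y s) p)
  have hpos' : 0 ≤ᵐ[volume.prod (volume.restrict (Ioo (0 : ℝ) t))]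
      fun q : E N × ℝ => Γ x q.1 (t - q.2) * u q.1 q.2 ^ p := hs.mono fun q hq => hpos q.1 q.2 hq
  have hpos1 : ∀ y, 0 ≤ Γ x y t * φ y := fun y => mul_nonneg (hΓ0 x y t ht) (hφ0 y)
  rw [h3, ENNReal.ofReal_add (integral_nonneg hpos1)
    (setIntegral_nonneg measurableSet_Ioo fun s hs => integral_nonneg fun y => hpos y s hs),
    ofReal_integral_eq_lintegral_ofReal h1 (ae_of_all _ hpos1), ← integral_prod_symm _ h2,
    ofReal_integral_eq_lintegral_ofReal h2 hpos',
    lintegral_prod_symm _ h2.aestronglyMeasurable.aemeasurable.ennreal_ofReal]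
  congr 1
  · exact lintegral_congr fun y => ENNReal.ofReal_mul (hΓ0 x y t ht)
  · refine setLIntegral_congr_fun measurableSet_Ioo fun s hs => lintegral_congr fun y => ?_
    rw [ENNReal.ofReal_mul (hΓ0 x y _ (sub_pos.2 hs.2)),
      ENNReal.ofReal_rpow_of_nonneg (hu0 y s) hp0]

/-- Lemma 3.1: there is a constant `C_*` depending only on `p` (independent of
the kernel, data and time horizon) such that any mild solution on `(0,T)`
satisfies `t^{1/(p-1)} ‖S(t)φ‖_∞ ≤ C_*` for `0 < t < T`. -/
theorem key_apriori_bound (N : ℕ) (hN : 1 ≤ N) (p : ℝ) (hp : 1 < p) :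
    ∃ Cstar : ℝ, ∀ Γ : E N → E N → ℝ → ℝ,
      Measurable (fun q : E N × E N × ℝ => Γ q.1 q.2.1 q.2.2) →
      (∀ x y : E N, ∀ t : ℝ, 0 < t → 0 ≤ Γ x y t) →
      (∀ x : E N, ∀ t : ℝ, 0 < t → ∫ y : E N, Γ x y t = 1) →
      (∀ x y : E N, ∀ s t : ℝ, 0 < s → s < t →
        Γ x y t = ∫ ξ : E N, Γ x ξ (t - s) * Γ ξ y s) →
      ∀ T : ℝ≥0∞, ∀ φ : E N → ℝ, Measurable φ → (∀ x, 0 ≤ φ x) →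
      ∀ u : E N → ℝ → ℝ, IsMildSolution N p Γ φ T u →
      ∀ t : ℝ, 0 < t → ENNReal.ofReal t < T →
        ENNReal.ofReal (t ^ (1 / (p - 1))) *
          eLpNorm (fun x => ∫ y, Γ x y t * φ y) ⊤ volume ≤ ENNReal.ofReal Cstar := by
  refine ⟨(2 / (1 - (2 : ℝ) ^ (1 - p))) ^ (1 / (p - 1)), ?_⟩
  intro Γ hΓ hΓ0 hΓ1 hCK T φ hφ hφ0 u hu t ht htT
  have hlt : ∀ τ, τ < t → ENNReal.ofReal τ < T := fun τ h =>
    (ENNReal.ofReal_le_ofReal h.le).trans_lt htT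
  obtain ⟨hum, hu0, ⟨M, hM⟩, -⟩ := id hu
  have bound : ∀ x, ENNReal.ofReal (t ^ (1 / (p - 1))) *
      ∫⁻ y, ENNReal.ofReal (Γ x y t) * ENNReal.ofReal (φ y) ≤ _ :=
    rpow_mul_lintegral_kernel_le (g := fun x y t => ENNReal.ofReal (Γ x y t))
      (Φ := fun y => ENNReal.ofReal (φ y)) (U := fun y s => ENNReal.ofReal (u y s)) hp ht
      hΓ.ennreal_ofReal
      (fun x t ht => by
        rw [← ofReal_integral_eq_lintegral_ofReal _ (ae_of_all _ fun y => hΓ0 x y t ht),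
          hΓ1 x t ht, ENNReal.ofReal_one]
        exact Integrable.of_integral_ne_zero (by simp [hΓ1 x t ht]))
      (fun x z s t hs hst => by
        rw [hCK x z s t hs hst]
        refine (ofReal_integral_le_lintegral_ofReal (ae_of_all _ fun y =>
          mul_nonneg (hΓ0 x y _ (sub_pos.2 hst)) (hΓ0 y z s hs))).trans_eq ?_
        exact lintegral_congr fun y => ENNReal.ofReal_mul (hΓ0 x y _ (sub_pos.2 hst)))
      hφ.ennreal_ofReal hum.ennreal_ofReal (M := ENNReal.ofReal M) ENNReal.ofReal_ne_top
      (fun τ h0 h1 => (hM τ h0 (hlt τ h1)).mono fun y hy => ENNReal.ofReal_le_ofReal hy)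
      (fun τ h0 h1 => (hu.lintegral_duhamel (by linarith) hΓ0 hφ0 h0 (hlt τ h1)).mono fun y hy => hy.ge)
  rw [eLpNorm_exponent_top, mul_comm, ← ENNReal.le_div_iff_mul_le
    (Or.inl (by simpa using by positivity)) (Or.inl ENNReal.ofReal_ne_top)]
  refine eLpNormEssSup_le_of_ae_enorm_bound (ae_of_all _ fun x => ?_)
  rw [ENNReal.le_div_iff_mul_le
    (Or.inl (by simpa using by positivity)) (Or.inl ENNReal.ofReal_ne_top), mul_comm]
  refine le_trans (mul_le_mul_right ?_ _) (bound x)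
  have hnn : ∀ y, 0 ≤ Γ x y t * φ y := fun y => mul_nonneg (hΓ0 x y t ht) (hφ0 y)
  rw [Real.enorm_of_nonneg (integral_nonneg hnn)]
  refine (ofReal_integral_le_lintegral_ofReal (ae_of_all _ hnn)).trans_eq ?_
  exact lintegral_congr fun y => ENNReal.ofReal_mul (hΓ0 x y t ht)
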